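/- For every g ∈ Sp(2,1), the set { trace(g·ι(A)·g⁻¹) : A ∈ SU(2,1) } is not contained in ℝ. That is, there exists A ∈ SU(2,1) such that trace(g·ι(A)·g⁻¹) is not real. -/

import Mathlib

open Matrix BigOperators

noncomputable section

abbrev Hq : Type := Quaternion ℝ

def qi : Hq := ⟨0, 1, 0, 0⟩
def qj : Hq := ⟨0, 0, 1, 0⟩
def qk : Hq := ⟨0, 0, 0, 1⟩

/-- A quaternion is real if all its imaginary parts vanish. -/
def isRealQ (q : Hq) : Prop := q.imI = 0 ∧ q.imJ = 0 ∧ q.imK = 0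

/-- The matrix `J_{n,1}` with diagonal `(1,…,1,−1)`. -/
def Jq (n : ℕ) : Matrix (Fin (n+1)) (Fin (n+1)) Hq :=
  Matrix.diagonal fun i => if i = Fin.last n then -1 else 1

/-- `Sp(n,1)` as a set of `(n+1)×(n+1)` quaternionic matrices. -/
def Sp (n : ℕ) : Set (Matrix (Fin (n+1)) (Fin (n+1)) Hq) :=
  {g | gᴴ * Jq n * g = Jq n}

/-- The complex matrix `J_{m,1}`. -/
def Jc (m : ℕ) : Matrix (Fin (m+1)) (Fin (m+1)) ℂ :=
  Matrix.diagonal fun i => if i = Fin.last m then -1 else 1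

/-- `SU(m,1)` as a set of `(m+1)×(m+1)` complex matrices. -/
def SU (m : ℕ) : Set (Matrix (Fin (m+1)) (Fin (m+1)) ℂ) :=
  {A | Aᴴ * Jc m * A = Jc m ∧ A.det = 1}

/-- The ℝ-algebra embedding `ℂ → ℍ`, `a + b√(−1) ↦ a + b i`. -/
def ι (z : ℂ) : Hq := ⟨z.re, z.im, 0, 0⟩


/-- The map `x ↦ x i x̄` from `ℍ` to imaginary quaternions squares the norm. -/
theorem norm_mul_qi_mul_star (x : Hq) : ‖x * qi * star x‖ = ‖x‖ ^ 2 := by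
  have h : ‖qi‖ * ‖qi‖ = 1 := by
    rw [← Quaternion.normSq_eq_norm_mul_self, Quaternion.normSq_def']
    simp [qi]
  have h' : ‖qi‖ = 1 := by nlinarith [norm_nonneg qi]
  rw [norm_mul, norm_mul, h', norm_star]
  ring

theorem sq_norm_le_of_mul_qi_mul_star_eq {x y z : Hq}
    (h : z * qi * star z = x * qi * star x + y * qi * star y) :
    ‖z‖ ^ 2 ≤ ‖x‖ ^ 2 + ‖y‖ ^ 2 := by
  rw [← norm_mul_qi_mul_star, ← norm_mul_qi_mul_star, ← norm_mul_qi_mul_star, h]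
  exact norm_add_le _ _

theorem Jq_mul_Jq (n : ℕ) : Jq n * Jq n = 1 := by
  rw [Jq, Matrix.diagonal_mul_diagonal, ← Matrix.diagonal_one]
  congr 1
  ext1 i
  split_ifs <;> simp

theorem Sp.ringInverse_eq {n : ℕ} {g : Matrix (Fin (n + 1)) (Fin (n + 1)) Hq} (hg : g ∈ Sp n) :
    Ring.inverse g = Jq n * gᴴ * Jq n := by
  have h : Jq n * gᴴ * Jq n * g = 1 := by
    rw [Matrix.mul_assoc, Matrix.mul_assoc, ← Matrix.mul_assoc gᴴ, show gᴴ * Jq n * g = Jq n from hg,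
      Jq_mul_Jq]
  exact Ring.inverse_unit ⟨g, _, mul_eq_one_comm.mp h, h⟩

/-- The last column of an element of `Sp(2,1)` is a negative vector. -/
theorem Sp.sq_norm_last_column {g : Matrix (Fin 3) (Fin 3) Hq} (hg : g ∈ Sp 2) :
    ‖g 2 2‖ ^ 2 = ‖g 0 2‖ ^ 2 + ‖g 1 2‖ ^ 2 + 1 := by
  have h := congrArg (fun M : Matrix (Fin 3) (Fin 3) Hq => (M 2 2).re)
    (show gᴴ * Jq 2 * g = Jq 2 from hg)
  simp [Matrix.mul_apply, Fin.sum_univ_three, Jq, Matrix.diagonal_apply, Fin.ext_iff] at h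
  rw [show QuaternionAlgebra.re (1 : Hq) = 1 from rfl] at h
  simp only [pow_two, ← Quaternion.normSq_eq_norm_mul_self, Quaternion.normSq_def']
  linarith

theorem diagonal_mem_SU_two {a b c : ℂ} (ha : star a * a = 1) (hb : star b * b = 1)
    (hc : star c * c = 1) (h : a * b * c = 1) : Matrix.diagonal ![a, b, c] ∈ SU 2 := by
  refine ⟨?_, by simp [Matrix.det_diagonal, Fin.prod_univ_three, h]⟩
  rw [Jc, Matrix.diagonal_conjTranspose, Matrix.diagonal_mul_diagonal,
    Matrix.diagonal_mul_diagonal]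
  congr 1
  ext1 i
  fin_cases i <;> simp_all [Fin.ext_iff]

theorem trace_conj_diagonal {g : Matrix (Fin 3) (Fin 3) Hq} (hg : g ∈ Sp 2) (a b c : ℂ) :
    (g * (Matrix.diagonal ![a, b, c]).map ι * Ring.inverse g).trace =
      (g 0 0 * ι a * star (g 0 0) + g 1 0 * ι a * star (g 1 0) - g 2 0 * ι a * star (g 2 0)) +
      (g 0 1 * ι b * star (g 0 1) + g 1 1 * ι b * star (g 1 1) - g 2 1 * ι b * star (g 2 1)) -
      (g 0 2 * ι c * star (g 0 2) + g 1 2 * ι c * star (g 1 2) - g 2 2 * ι c * star (g 2 2)) := by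
  have h0 : ι 0 = 0 := rfl
  have e0 : (0 : Fin 3) ≠ Fin.last 2 := by decide
  have e1 : (1 : Fin 3) ≠ Fin.last 2 := by decide
  have e2 : (2 : Fin 3) = Fin.last 2 := rfl
  rw [Sp.ringInverse_eq hg, Matrix.diagonal_map h0, Jq]
  rw [Matrix.trace_fin_three, Matrix.mul_apply, Matrix.mul_apply, Matrix.mul_apply]
  simp only [Fin.sum_univ_three, Matrix.mul_diagonal, Matrix.diagonal_mul,
    Matrix.conjTranspose_apply, if_neg e0, if_neg e1, if_pos e2, Matrix.cons_val, mul_one, one_mul,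
    mul_neg, neg_mul, neg_neg]
  abel

theorem ι_neg (z : ℂ) : ι (-z) = -ι z := by
  ext <;>
    simp only [Quaternion.re_neg, Quaternion.imI_neg, Quaternion.imJ_neg, Quaternion.imK_neg] <;>
    simp [ι]

theorem isRealQ.star_eq {q : Hq} (h : isRealQ q) : star q = q := by
  obtain ⟨hi, hj, hk⟩ := h
  ext <;> simp [hi, hj, hk]

theorem star_mul_qi_mul_star (x : Hq) : star (x * qi * star x) = -(x * qi * star x) := by
  have h : star qi = -qi := by
    ext <;>
      simp only [Quaternion.re_star, Quaternion.imI_star, Quaternion.imJ_star, Quaternion.imK_star,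
        Quaternion.re_neg, Quaternion.imI_neg, Quaternion.imJ_neg, Quaternion.imK_neg] <;>
      simp [qi]
  rw [star_mul, star_mul, star_star, h, neg_mul, mul_neg, mul_assoc]

/-- for every `g ∈ Sp(2,1)` the set of traces of `g·ι(SU(2,1))·g⁻¹` is not
contained in `ℝ`: some `A ∈ SU(2,1)` gives a non-real trace. -/
theorem stmt7 (g : Matrix (Fin 3) (Fin 3) Hq) (hg : g ∈ Sp 2) :
    ∃ A ∈ SU 2, ¬ isRealQ ((g * A.map ι * Ring.inverse g).trace) := by
  have hI : star Complex.I * Complex.I = 1 := by simp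
  have hnI : star (-Complex.I) * -Complex.I = 1 := by simp
  by_contra! hreal
  have h₁ := (hreal _ (diagonal_mem_SU_two (a := 1) (by simp) hnI hI (by simp))).star_eq
  have h₂ := (hreal _ (diagonal_mem_SU_two (a := -1) (by simp) hI hI (by simp))).star_eq
  have ι_one : ι 1 = 1 := by ext <;> rfl
  have ι_I : ι Complex.I = qi := by ext <;> simp [ι, qi]
  rw [trace_conj_diagonal hg] at h₁ h₂
  simp only [ι_neg, ι_one, ι_I, mul_neg, neg_mul, star_add, star_sub, star_neg,
    star_mul_qi_mul_star] at h₁ h₂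
  simp only [mul_one, star_mul, star_star] at h₁ h₂
  have hv : g 2 2 * qi * star (g 2 2) =
      g 0 2 * qi * star (g 0 2) + g 1 2 * qi * star (g 1 2) := by
    linear_combination (norm := module) (-1 / 4 : ℝ) • h₁ + (-1 / 4 : ℝ) • h₂
  have hle := sq_norm_le_of_mul_qi_mul_star_eq hv
  linarith [Sp.sq_norm_last_column hg]
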